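/- Let d, M ≥ 1, let ρ_0,…,ρ_{M−1} be density matrices on ℂ^d, let Y_0,…,Y_{M−1} be positive semidefinite Hermitian d×d complex matrices with Σ_{w} Y_w ≤ I (in the Loewner order), suppose σ := (1/M)·Σ_w ρ_w is positive definite, and let s ∈ (0,1). Then the average success probability p := (1/M)·Σ_w Tr(ρ_w Y_w) satisfies p^{1+s} · M^s ≤ (1/M)·Σ_{w=0}^{M−1} Tr(ρ_w^{1+s} · σ^{−s}), where matrix powers are defined by Hermitian functional calculus. (This is the hypothesis-testing/Rényi-divergence step of the strong converse proof.) -/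

import Mathlib

open Matrix
open scoped ComplexOrder

/-- Hermitian functional calculus: `A^r` obtained by applying the real power `t ↦ t^r`
to the eigenvalues in a spectral decomposition of the Hermitian matrix `A`. -/
noncomputable def hermPow {d : ℕ} {A : Matrix (Fin d) (Fin d) ℂ} (hA : A.IsHermitian)
    (r : ℝ) : Matrix (Fin d) (Fin d) ℂ :=
  (hA.eigenvectorUnitary : Matrix (Fin d) (Fin d) ℂ) *
    Matrix.diagonal (fun i => ((hA.eigenvalues i ^ r : ℝ) : ℂ)) *
    star (hA.eigenvectorUnitary : Matrix (Fin d) (Fin d) ℂ)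

/-- The squared modulus of the overlap between the `i`-th eigenvector of `A` and the `j`-th
eigenvector of `B`. -/
noncomputable def eigenOverlap {d : ℕ} {A B : Matrix (Fin d) (Fin d) ℂ} (hA : A.IsHermitian)
    (hB : B.IsHermitian) (i j : Fin d) : ℝ :=
  Complex.normSq ((star (hA.eigenvectorUnitary : Matrix (Fin d) (Fin d) ℂ) *
    (hB.eigenvectorUnitary : Matrix (Fin d) (Fin d) ℂ)) i j)

lemma eigenOverlap_nonneg {d : ℕ} {A B : Matrix (Fin d) (Fin d) ℂ} (hA : A.IsHermitian)
    (hB : B.IsHermitian) (i j : Fin d) : 0 ≤ eigenOverlap hA hB i j :=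
  Complex.normSq_nonneg _

lemma eq_eigenvectorUnitary_mul_diagonal_mul_star {d : ℕ} {A : Matrix (Fin d) (Fin d) ℂ}
    (hA : A.IsHermitian) :
    A = (hA.eigenvectorUnitary : Matrix (Fin d) (Fin d) ℂ) *
      diagonal (fun i => ((hA.eigenvalues i : ℝ) : ℂ)) *
      star (hA.eigenvectorUnitary : Matrix (Fin d) (Fin d) ℂ) := by
  conv_lhs => rw [hA.spectral_theorem, Unitary.conjStarAlgAut_apply]
  rfl

lemma re_trace_diagonal_mul_mul_conjTranspose {d : ℕ} (f : Fin d → ℝ)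
    (X K : Matrix (Fin d) (Fin d) ℂ) :
    ((diagonal (fun i => (f i : ℂ)) * X * Kᴴ).trace).re =
      ∑ i, ∑ j, f i * (X i j * star (K i j)).re := by
  rw [Matrix.mul_assoc]
  simp only [trace, diag_apply, diagonal_mul, Complex.re_sum, Complex.re_ofReal_mul,
    mul_apply (M := X), conjTranspose_apply, Finset.mul_sum]

lemma re_trace_diagonal_mul_mul_diagonal_mul {d : ℕ} (f g : Fin d → ℝ)
    (X : Matrix (Fin d) (Fin d) ℂ) :
    ((diagonal (fun i => (f i : ℂ)) * X * (diagonal (fun i => (g i : ℂ)) * Xᴴ)).trace).re =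
      ∑ i, ∑ j, f i * g j * Complex.normSq (X i j) := by
  simp only [trace, diag_apply, mul_apply (M := diagonal _ * X), diagonal_mul,
    conjTranspose_apply, Complex.re_sum]
  refine Finset.sum_congr rfl fun i _ => Finset.sum_congr rfl fun j _ => ?_
  simp only [Complex.mul_re, Complex.mul_im, Complex.ofReal_re, Complex.ofReal_im,
    Complex.star_def, Complex.conj_re, Complex.conj_im, Complex.normSq_apply]
  ring

lemma re_trace_hermPow_mul_hermPow {d : ℕ} {A B : Matrix (Fin d) (Fin d) ℂ}
    (hA : A.IsHermitian) (hB : B.IsHermitian) (r r' : ℝ) :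
    ((hermPow hA r * hermPow hB r').trace).re =
      ∑ i, ∑ j, hA.eigenvalues i ^ r * hB.eigenvalues j ^ r' * eigenOverlap hA hB i j := by
  unfold eigenOverlap
  rw [← re_trace_diagonal_mul_mul_diagonal_mul]
  simp only [hermPow, mul_assoc]
  rw [trace_mul_comm]
  simp only [mul_assoc, conjTranspose_mul, star_eq_conjTranspose, conjTranspose_conjTranspose]

lemma trace_mul_eq_trace_diagonal {d : ℕ} {A : Matrix (Fin d) (Fin d) ℂ} (hA : A.IsHermitian)
    (Z : Matrix (Fin d) (Fin d) ℂ) :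
    (A * Z).trace = (diagonal (fun i => ((hA.eigenvalues i : ℝ) : ℂ)) *
      (star (hA.eigenvectorUnitary : Matrix (Fin d) (Fin d) ℂ) * Z *
        (hA.eigenvectorUnitary : Matrix (Fin d) (Fin d) ℂ))).trace := by
  conv_lhs => rw [eq_eigenvectorUnitary_mul_diagonal_mul_star hA]
  simp only [mul_assoc]
  rw [trace_mul_comm]
  simp only [mul_assoc]

lemma Matrix.PosSemidef.re_trace_mul_nonneg {d : ℕ} {A B : Matrix (Fin d) (Fin d) ℂ}
    (hA : A.PosSemidef) (hB : B.PosSemidef) : 0 ≤ ((A * B).trace).re := by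
  rw [trace_mul_eq_trace_diagonal hA.1]
  simp only [trace, diag_apply, diagonal_mul, Complex.re_sum, Complex.re_ofReal_mul]
  refine Finset.sum_nonneg fun i _ => mul_nonneg (hA.eigenvalues_nonneg i) ?_
  exact (Complex.le_def.1 ((hB.conjTranspose_mul_mul_same _).diag_nonneg (i := i))).1

lemma Matrix.PosSemidef.sub_mul_self {d : ℕ} {Y : Matrix (Fin d) (Fin d) ℂ}
    (hY : Y.PosSemidef) (hY1 : (1 - Y).PosSemidef) : (Y - Y * Y).PosSemidef := by
  have h := (hY1.mul_mul_conjTranspose_same Y).add (hY.mul_mul_conjTranspose_same (1 - Y))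
  rw [hY.1.eq, hY1.1.eq] at h
  convert h using 1
  noncomm_ring

lemma Matrix.PosSemidef.re_trace_mul_mul_self_le {d : ℕ} {A Y : Matrix (Fin d) (Fin d) ℂ}
    (hA : A.PosSemidef) (hY : Y.PosSemidef) (hY1 : (1 - Y).PosSemidef) :
    ((A * (Y * Y)).trace).re ≤ ((A * Y).trace).re := by
  have h := hA.re_trace_mul_nonneg (hY.sub_mul_self hY1)
  rw [mul_sub, trace_sub, Complex.sub_re] at h
  linarith

lemma two_mul_sub_le_div {a b t c : ℝ} (x k : ℂ) (ha : 0 ≤ a) (hb : 0 < b) (ht : 0 < t) :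
    2 * c * (a * (x * star k).re) - c ^ 2 * ((a + t * b) * Complex.normSq x) ≤
      a * Complex.normSq k * (a / b / (t + a / b)) := by
  have hpos : 0 < a + t * b := by positivity
  have e : a * Complex.normSq k * (a / b / (t + a / b)) =
      Complex.normSq k * a ^ 2 / (a + t * b) := by
    have : t + a / b = (a + t * b) / b := by field_simp; ring
    rw [this]
    field_simp
  rw [e, le_div_iff₀ hpos]
  simp only [Complex.mul_re, Complex.star_def, Complex.conj_re, Complex.conj_im,
    Complex.normSq_apply]
  nlinarith [sq_nonneg (a * k.re - c * (a + t * b) * x.re),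
    sq_nonneg (a * k.im - c * (a + t * b) * x.im)]

/-- Variational lower bound for the resolvent form of the relative modular operator. -/
lemma two_mul_re_trace_sub_le {d : ℕ} {A B Y : Matrix (Fin d) (Fin d) ℂ}
    (hA : A.PosSemidef) (hB : B.PosDef) (hY : Y.IsHermitian) {t : ℝ} (ht : 0 < t) (c : ℝ) :
    2 * c * ((A * Y).trace).re -
        c ^ 2 * (((A * (Y * Y)).trace).re + t * ((B * (Y * Y)).trace).re) ≤
      ∑ i, ∑ j, hA.1.eigenvalues i * eigenOverlap hA.1 hB.1 i j *
        (hA.1.eigenvalues i / hB.1.eigenvalues j /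
          (t + hA.1.eigenvalues i / hB.1.eigenvalues j)) := by
  set U : Matrix (Fin d) (Fin d) ℂ := (hA.1.eigenvectorUnitary : Matrix (Fin d) (Fin d) ℂ)
    with hU
  set V : Matrix (Fin d) (Fin d) ℂ := (hB.1.eigenvectorUnitary : Matrix (Fin d) (Fin d) ℂ)
    with hV
  have hUU : U * Uᴴ = 1 := Unitary.mul_star_self_of_mem hA.1.eigenvectorUnitary.2
  have hVV : V * Vᴴ = 1 := Unitary.mul_star_self_of_mem hB.1.eigenvectorUnitary.2
  have hUU' (Z : Matrix (Fin d) (Fin d) ℂ) : U * (Uᴴ * Z) = Z := by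
    rw [← mul_assoc, hUU, one_mul]
  have hVV' (Z : Matrix (Fin d) (Fin d) ℂ) : V * (Vᴴ * Z) = Z := by
    rw [← mul_assoc, hVV, one_mul]
  set a := hA.1.eigenvalues
  set b := hB.1.eigenvalues
  set X := Uᴴ * Y * V with hX
  set K := Uᴴ * V with hK
  have e1 : ((A * Y).trace).re = ∑ i, ∑ j, a i * (X i j * star (K i j)).re := by
    rw [← re_trace_diagonal_mul_mul_conjTranspose, trace_mul_eq_trace_diagonal hA.1]
    simp only [hX, hK, star_eq_conjTranspose, conjTranspose_mul, conjTranspose_conjTranspose,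
      mul_assoc, hVV', ← hU, a]
  have e2 : ((A * (Y * Y)).trace).re = ∑ i, ∑ j, a i * Complex.normSq (X i j) := by
    have h := re_trace_diagonal_mul_mul_diagonal_mul a (fun _ => 1) X
    simp only [mul_one, Complex.ofReal_one, diagonal_one, one_mul] at h
    rw [← h, trace_mul_eq_trace_diagonal hA.1]
    simp only [hX, star_eq_conjTranspose, conjTranspose_mul, conjTranspose_conjTranspose,
      mul_assoc, hVV', hY.eq, ← hU, a]
  have e3 : ((B * (Y * Y)).trace).re = ∑ i, ∑ j, b j * Complex.normSq (X i j) := by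
    have h := re_trace_diagonal_mul_mul_diagonal_mul (fun _ => 1) b X
    simp only [one_mul, Complex.ofReal_one, diagonal_one] at h
    rw [← h, trace_mul_eq_trace_diagonal hB.1, trace_mul_comm X]
    simp only [hX, star_eq_conjTranspose, conjTranspose_mul, conjTranspose_conjTranspose,
      mul_assoc, hUU', hY.eq, ← hV, b]
  rw [e1, e2, e3]
  simp only [Finset.mul_sum, ← Finset.sum_add_distrib, ← Finset.sum_sub_distrib]
  refine Finset.sum_le_sum fun i _ => Finset.sum_le_sum fun j _ => ?_
  refine le_trans (le_of_eq ?_)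
    (two_mul_sub_le_div (c := c) (X i j) (K i j) (hA.eigenvalues_nonneg i)
      (hB.eigenvalues_pos j) ht)
  ring

/-- A comparison of resolvents `x / (t + x)` for all `t > 0` integrates to a comparison of
`s`-th powers. -/
lemma mul_rpow_le_sum_mul_rpow {ι : Type*} [Fintype ι] {s P : ℝ} (hs : s ∈ Set.Ioo (0 : ℝ) 1)
    (hP : 0 ≤ P) (m x : ι → ℝ) (hx : ∀ k, 0 ≤ x k)
    (h : ∀ t : ℝ, 0 < t → P * (P / (t + P)) ≤ ∑ k, m k * (x k / (t + x k))) :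
    P * P ^ s ≤ ∑ k, m k * x k ^ s := by
  obtain ⟨μ, hμ⟩ := Real.exists_measure_rpow_eq_integral_rpowIntegrand₀₁ hs
  rw [(hμ P hP).2, ← MeasureTheory.integral_const_mul]
  simp only [fun k => (hμ (x k) (hx k)).2, ← MeasureTheory.integral_const_mul]
  rw [← MeasureTheory.integral_finsetSum _ fun k _ => ((hμ (x k) (hx k)).1.const_mul (m k))]
  refine MeasureTheory.setIntegral_mono_on ((hμ P hP).1.const_mul P)
    (MeasureTheory.integrable_finsetSum _ fun k _ => ((hμ (x k) (hx k)).1.const_mul (m k)))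
    measurableSet_Ioi fun t ht => ?_
  have ht' : 0 < t := ht
  simp only [Real.rpowIntegrand₀₁_eq_pow_div hs ht'.le hP,
    fun k => Real.rpowIntegrand₀₁_eq_pow_div hs ht'.le (hx k)]
  have h2 := mul_le_mul_of_nonneg_left (h t ht') (Real.rpow_nonneg ht'.le (s - 1))
  rw [Finset.mul_sum] at h2
  convert h2 using 1
  · ring
  · exact Finset.sum_congr rfl fun k _ => by ring

/-- For a sub-POVM `Y` and any positive definite `σ` of unit trace, the Petz quantities of the
pairs `(ρ_w, σ)` dominate the power of the total success weight. -/
lemma sum_re_trace_rpow_le {d : ℕ} {ι : Type*} [Fintype ι] {ρ Y : ι → Matrix (Fin d) (Fin d) ℂ}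
    (hρ : ∀ w, (ρ w).PosSemidef) (hY : ∀ w, (Y w).PosSemidef)
    (hYle : ((1 : Matrix (Fin d) (Fin d) ℂ) - ∑ w, Y w).PosSemidef)
    {σ : Matrix (Fin d) (Fin d) ℂ} (hσ : σ.PosDef) (hσtr : σ.trace = 1)
    {s : ℝ} (hs : s ∈ Set.Ioo (0 : ℝ) 1) :
    (∑ w, ((ρ w * Y w).trace).re) ^ (1 + s) ≤
      ∑ w, ((hermPow (hρ w).1 (1 + s) * hermPow hσ.1 (-s)).trace).re := by
  classical
  set P := ∑ w, ((ρ w * Y w).trace).re with hPdef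
  have hP : 0 ≤ P := Finset.sum_nonneg fun w _ => (hρ w).re_trace_mul_nonneg (hY w)
  have hY1 (w : ι) : (1 - Y w).PosSemidef := by
    have h : (1 : Matrix (Fin d) (Fin d) ℂ) - Y w =
        (1 - ∑ v, Y v) + ∑ v ∈ Finset.univ.erase w, Y v := by
      rw [← Finset.add_sum_erase _ _ (Finset.mem_univ w)]
      abel
    rw [h]
    exact hYle.add (posSemidef_sum _ fun v _ => hY v)
  have hQ : ∑ w, ((σ * Y w).trace).re ≤ 1 := by
    have h := hσ.posSemidef.re_trace_mul_nonneg hYle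
    rw [mul_sub, mul_one, trace_sub, hσtr, Finset.mul_sum, trace_sum, Complex.sub_re,
      Complex.re_sum, Complex.one_re] at h
    linarith
  let m : ι × Fin d × Fin d → ℝ := fun k =>
    (hρ k.1).1.eigenvalues k.2.1 * eigenOverlap (hρ k.1).1 hσ.1 k.2.1 k.2.2
  let x : ι × Fin d × Fin d → ℝ := fun k =>
    (hρ k.1).1.eigenvalues k.2.1 / hσ.1.eigenvalues k.2.2
  have hx (k) : 0 ≤ x k :=
    div_nonneg ((hρ k.1).eigenvalues_nonneg _) (hσ.eigenvalues_pos _).le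
  have resolvent (t : ℝ) (ht : 0 < t) : P * (P / (t + P)) ≤ ∑ k, m k * (x k / (t + x k)) := by
    set c := P / (t + P) with hc
    have hsum := Finset.sum_le_sum fun w (_ : w ∈ Finset.univ) =>
      two_mul_re_trace_sub_le (hρ w) hσ (hY w).1 ht c
    rw [Finset.sum_sub_distrib, ← Finset.mul_sum, ← Finset.mul_sum, Finset.sum_add_distrib,
      ← Finset.mul_sum, ← hPdef] at hsum
    have h1 : ∑ w, ((ρ w * (Y w * Y w)).trace).re ≤ P :=
      Finset.sum_le_sum fun w _ => (hρ w).re_trace_mul_mul_self_le (hY w) (hY1 w)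
    have h2 : ∑ w, ((σ * (Y w * Y w)).trace).re ≤ 1 :=
      (Finset.sum_le_sum fun w _ =>
        hσ.posSemidef.re_trace_mul_mul_self_le (hY w) (hY1 w)).trans hQ
    have h3 : c ^ 2 * (∑ w, ((ρ w * (Y w * Y w)).trace).re +
        t * ∑ w, ((σ * (Y w * Y w)).trace).re) ≤ c ^ 2 * (P + t * 1) := by gcongr
    have h4 : c * (t + P) = P := div_mul_cancel₀ _ (by positivity)
    have h5 : c ^ 2 * (P + t * 1) = c * P := by linear_combination c * h4
    simp only [Fintype.sum_prod_type, m, x]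
    linarith
  have key := mul_rpow_le_sum_mul_rpow hs hP m x hx resolvent
  rw [Real.rpow_add' hP (by linarith [hs.1]), Real.rpow_one]
  refine key.trans_eq ?_
  simp only [Fintype.sum_prod_type, re_trace_hermPow_mul_hermPow, m, x]
  refine Finset.sum_congr rfl fun w _ => Finset.sum_congr rfl fun i _ =>
    Finset.sum_congr rfl fun j _ => ?_
  have ha := (hρ w).eigenvalues_nonneg i
  have hb := hσ.eigenvalues_pos j
  rw [Real.rpow_add' ha (by linarith [hs.1]), Real.rpow_one, Real.div_rpow ha hb.le,
    Real.rpow_neg hb.le]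
  ring

/-- Hypothesis-testing/Rényi-divergence step of the strong converse proof: the average
success probability `p = (1/M) Σ_w Tr(ρ_w Y_w)` of a sub-POVM `{Y_w}` on density matrices
`ρ_w` with positive definite average `σ` satisfies
`p^{1+s} M^s ≤ (1/M) Σ_w Tr(ρ_w^{1+s} σ^{−s})`. -/
theorem renyi_success_bound (d M : ℕ) (hd : 1 ≤ d) (hM : 1 ≤ M)
    (ρ : Fin M → Matrix (Fin d) (Fin d) ℂ)
    (hρ : ∀ w, (ρ w).PosSemidef) (htr : ∀ w, (ρ w).trace = 1)
    (Y : Fin M → Matrix (Fin d) (Fin d) ℂ)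
    (hY : ∀ w, (Y w).PosSemidef)
    (hYle : ((1 : Matrix (Fin d) (Fin d) ℂ) - ∑ w, Y w).PosSemidef)
    (σ : Matrix (Fin d) (Fin d) ℂ) (hσdef : σ = (M : ℂ)⁻¹ • ∑ w, ρ w)
    (hσ : σ.PosDef)
    (s : ℝ) (hs : s ∈ Set.Ioo (0 : ℝ) 1) :
    ((M : ℝ)⁻¹ * ∑ w, ((ρ w * Y w).trace).re) ^ (1 + s) * (M : ℝ) ^ s ≤
      (M : ℝ)⁻¹ * ∑ w,
        ((hermPow (hρ w).1 (1 + s) * hermPow hσ.1 (-s)).trace).re := by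
  have hM0 : (0 : ℝ) < M := by exact_mod_cast hM
  have hσtr : σ.trace = 1 := by
    have hMC : (M : ℂ) ≠ 0 := by exact_mod_cast hM0.ne'
    rw [hσdef, trace_smul, trace_sum]
    simp [htr, hMC]
  have hmain := sum_re_trace_rpow_le hρ hY hYle hσ hσtr hs
  have hP : 0 ≤ ∑ w, ((ρ w * Y w).trace).re :=
    Finset.sum_nonneg fun w _ => (hρ w).re_trace_mul_nonneg (hY w)
  have hMpow : ((M : ℝ)⁻¹) ^ (1 + s) * (M : ℝ) ^ s = (M : ℝ)⁻¹ := by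
    rw [Real.inv_rpow hM0.le, Real.rpow_add hM0, Real.rpow_one]
    have := (Real.rpow_pos_of_pos hM0 s).ne'
    field_simp
  rw [Real.mul_rpow (inv_nonneg.2 hM0.le) hP, mul_right_comm, hMpow]
  exact mul_le_mul_of_nonneg_left hmain (inv_nonneg.2 hM0.le)
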